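/- Let m₁ be a positive integer, λ > 0, C > 0, τ > 0, α₂ > 0, μ₂ > 0 and Ῡ > 0. Let γ₁ and γ₂ be independent random variables, where γ₁ has the Gamma(m₁, λ) density and γ₂ has the α-μ density with parameters (α₂, μ₂, Ῡ), with density f₂. Then E[ erfc( √( τ · γ₁γ₂/(γ₂ + C) ) ) ] = 1 − √(τ/π) · Σ_{n=0}^{m₁−1} (1/n!) Σ_{p=0}^{n} C(n,p) λ^{n} C^{p} ∫_0^∞ z^{n−1/2} e^{−(τ+λ)z} ( ∫_0^∞ x^{−p} e^{−λCz/x} f₂(x) dx ) dz, where erfc(u) = (2/√π) ∫_u^∞ e^{−t²} dt and C(n,p) denotes the binomial coefficient. -/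

import Mathlib

open MeasureTheory ProbabilityTheory

/-- The complementary Gaussian error function `erfc u = (2 / √π) ∫_u^∞ e^{-t²} dt`. -/
noncomputable def erfc (u : ℝ) : ℝ := (2 / Real.sqrt Real.pi) * ∫ t in Set.Ioi u, Real.exp (-t ^ 2)

/-- The complementary error function as an integral of the density of `z ↦ erf √(τ z)`. -/
lemma erfc_sqrt_eq {τ : ℝ} (hτ : 0 < τ) (s : ℝ) :
    erfc (Real.sqrt (τ * s)) = 1 - ∫ z in Set.Ioi (0 : ℝ),
      Real.sqrt (τ / Real.pi) * (z ^ (-(1 / 2) : ℝ) * Real.exp (-τ * z))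
        * (Set.Iio s).indicator 1 z := by
  set u := Real.sqrt (τ * s) with hu
  have hu0 : 0 ≤ u := Real.sqrt_nonneg _
  set g : ℝ → ℝ := fun t => Real.exp (-t ^ 2) with hg
  have hgi : Integrable g := by
    simpa [hg] using integrable_exp_neg_mul_sq (b := 1) one_pos
  have hgauss : ∫ t in Set.Ioi (0 : ℝ), g t = Real.sqrt Real.pi / 2 := by
    simpa [hg] using integral_gaussian_Ioi 1
  have hsplit : (∫ t in Set.Ioi (0 : ℝ), g t)
      = (∫ t in Set.Ioi (0 : ℝ), (Set.Iio u).indicator g t) + ∫ t in Set.Ioi u, g t := by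
    have h1 : ∫ t in Set.Ioi u, g t = ∫ t in Set.Ioi (0 : ℝ), (Set.Ici u).indicator g t := by
      rw [setIntegral_indicator measurableSet_Ici, ← integral_Ici_eq_integral_Ioi]
      apply setIntegral_congr_set
      rcases hu0.eq_or_lt with h | h
      · rw [← h]
        have : Set.Ioi (0 : ℝ) ∩ Set.Ici 0 = Set.Ioi 0 := by
          ext x; simp; exact le_of_lt
        rw [this]; exact Ioi_ae_eq_Ici.symm
      · have : Set.Ioi (0 : ℝ) ∩ Set.Ici u = Set.Ici u := by
          ext x; simp; intro hx; linarith
        rw [this]; exact Filter.EventuallyEq.rfl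
    rw [h1, ← integral_add (hgi.integrableOn.indicator measurableSet_Iio)
      (hgi.integrableOn.indicator measurableSet_Ici)]
    refine integral_congr_ae (Filter.Eventually.of_forall fun t => ?_)
    by_cases h : t < u
    · simp [Set.indicator, h]
    · simp [Set.indicator, h, not_lt.mp h]
  have hsub : (∫ t in Set.Ioi (0 : ℝ), (Set.Iio u).indicator g t)
      = τ * ∫ z in Set.Ioi (0 : ℝ), (1 / 2 * (τ * z) ^ (1 / 2 - 1 : ℝ))
        * (Set.Iio u).indicator g ((τ * z) ^ (1 / 2 : ℝ)) := by
    have h := integral_comp_mul_left_Ioi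
      (fun y : ℝ => (1 / 2 * y ^ (1 / 2 - 1 : ℝ)) * (Set.Iio u).indicator g (y ^ (1 / 2 : ℝ)))
      0 hτ
    rw [h, mul_zero, smul_eq_mul, ← mul_assoc, mul_inv_cancel₀ hτ.ne', one_mul,
      ← integral_comp_rpow_Ioi _ (p := 1 / 2) (by norm_num)]
    simp [abs_of_pos]
  have hpi : Real.sqrt Real.pi ≠ 0 := (Real.sqrt_pos.mpr Real.pi_pos).ne'
  have hmain : (2 / Real.sqrt Real.pi) * (∫ t in Set.Ioi (0 : ℝ), (Set.Iio u).indicator g t)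
      = ∫ z in Set.Ioi (0 : ℝ),
      Real.sqrt (τ / Real.pi) * (z ^ (-(1 / 2) : ℝ) * Real.exp (-τ * z))
        * (Set.Iio s).indicator 1 z := by
    rw [hsub, ← mul_assoc, ← integral_const_mul]
    refine setIntegral_congr_fun measurableSet_Ioi fun z hz => ?_
    have hz : 0 < z := hz
    have hτz : 0 < τ * z := mul_pos hτ hz
    have hiff : (τ * z) ^ (1 / 2 : ℝ) < u ↔ z < s := by
      rw [← Real.sqrt_eq_rpow, hu, Real.sqrt_lt_sqrt_iff hτz.le, mul_lt_mul_iff_right₀ hτ]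
    have hpow : (τ * z) ^ (1 / 2 - 1 : ℝ) = z ^ (-(1 / 2) : ℝ) / Real.sqrt τ := by
      rw [Real.mul_rpow hτ.le hz.le, Real.sqrt_eq_rpow,
        show (1 / 2 - 1 : ℝ) = -(1 / 2) by norm_num, Real.rpow_neg hτ.le]
      field_simp
    by_cases h : z < s
    · have h' := hiff.mpr h
      simp only [Set.indicator, Set.mem_Iio, h, h', if_true, hg, Pi.one_apply, mul_one]
      rw [hpow, ← Real.sqrt_eq_rpow, Real.sq_sqrt hτz.le, Real.sqrt_div hτ.le, neg_mul]
      have hτs : Real.sqrt τ ≠ 0 := (Real.sqrt_pos.mpr hτ).ne'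
      field_simp
      rw [Real.sq_sqrt hτ.le]
    · have h' := mt hiff.mp h
      simp only [Set.indicator, Set.mem_Iio, h, h', if_false, mul_zero]
  rw [← hmain, erfc]
  have : ∫ t in Set.Ioi u, g t
      = Real.sqrt Real.pi / 2 - ∫ t in Set.Ioi (0 : ℝ), (Set.Iio u).indicator g t := by
    rw [← hgauss, hsplit]; ring
  change 2 / Real.sqrt Real.pi * ∫ t in Set.Ioi u, g t = _
  rw [this]
  field_simp

/-- The survival function of the Erlang distribution. -/
lemma setLIntegral_Ioi_erlang {m : ℕ} (hm : 0 < m) {r : ℝ} (hr : 0 < r) {t : ℝ} (ht : 0 ≤ t) :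
    ∫⁻ x in Set.Ioi t, ENNReal.ofReal
      (r ^ m * x ^ (m - 1) * Real.exp (-r * x) / Real.Gamma (m : ℝ))
      = ENNReal.ofReal (∑ n ∈ Finset.range m, Real.exp (-r * t) * (r * t) ^ n / n.factorial) := by
  set F : ℝ → ℝ := fun x =>
    -∑ n ∈ Finset.range m, Real.exp (-r * x) * (r * x) ^ n / n.factorial with hF
  set g : ℝ → ℝ := fun x =>
    r ^ m * x ^ (m - 1) * Real.exp (-r * x) / Real.Gamma (m : ℝ) with hg
  have hderiv : ∀ x, HasDerivAt F (g x) x := by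
    obtain ⟨k, rfl⟩ : ∃ k, m = k + 1 := ⟨m - 1, by omega⟩
    intro x
    have hexp : HasDerivAt (fun x => Real.exp (-r * x)) (Real.exp (-r * x) * (-r)) x := by
      simpa using ((hasDerivAt_id x).const_mul (-r)).exp
    have key : ∀ k : ℕ, HasDerivAt
        (fun x => ∑ n ∈ Finset.range (k + 1), Real.exp (-r * x) * (r * x) ^ n / n.factorial)
        (-(r ^ (k + 1) * x ^ k * Real.exp (-r * x) / k.factorial)) x := by
      intro k
      induction k with
      | zero =>
        simp only [zero_add, Finset.sum_range_one, pow_zero, Nat.factorial_zero, Nat.cast_one,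
          div_one, mul_one, pow_one]
        exact hexp.congr_deriv (by ring)
      | succ k ih =>
        simp only [Finset.sum_range_succ _ (k + 1)]
        have hp : HasDerivAt (fun x => (r * x) ^ (k + 1)) (((k + 1 : ℕ) : ℝ) * (r * x) ^ k * r) x := by
          simpa using ((hasDerivAt_id x).const_mul r).fun_pow (k + 1)
        refine (ih.add ((hexp.mul hp).div_const ((k + 1).factorial : ℝ))).congr_deriv ?_
        rw [Nat.factorial_succ]
        have := k.factorial_ne_zero
        push_cast
        field_simp
        ring
    have := (key k).neg
    simp only [hg, Nat.add_sub_cancel]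
    push_cast
    rw [Real.Gamma_nat_eq_factorial]
    exact this.congr_deriv (neg_neg _)
  have hlim : Filter.Tendsto F Filter.atTop (nhds 0) := by
    have : Filter.Tendsto F Filter.atTop
        (nhds (-∑ n ∈ Finset.range m, (0 : ℝ) / n.factorial)) := by
      refine (tendsto_finsetSum _ fun n _ => ?_).neg
      refine Filter.Tendsto.div_const ?_ _
      have h := (Real.tendsto_pow_mul_exp_neg_atTop_nhds_zero n).comp
        (Filter.tendsto_id.const_mul_atTop hr)
      refine h.congr fun x => ?_
      simp [mul_comm]
    simpa using this
  have hnn : ∀ x ∈ Set.Ioi t, 0 ≤ g x := by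
    intro x hx
    have hx : 0 < x := lt_of_le_of_lt ht hx
    have := Real.Gamma_pos_of_pos (s := (m : ℝ)) (by exact_mod_cast hm)
    positivity
  have hc : ContinuousWithinAt F (Set.Ici t) t := (hderiv t).continuousAt.continuousWithinAt
  rw [← ofReal_integral_eq_lintegral_ofReal
    (integrableOn_Ioi_deriv_of_nonneg hc (fun x _ => hderiv x) hnn hlim)
    ((ae_restrict_mem measurableSet_Ioi).mono hnn),
    integral_Ioi_of_hasDerivAt_of_nonneg hc (fun x _ => hderiv x) hnn hlim]
  simp [hF]

lemma rpow_neg_mul_exp_neg_div_le (p : ℕ) {a x : ℝ} (ha : 0 < a) (hx : 0 < x) :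
    x ^ (-(p : ℝ)) * Real.exp (-a / x) ≤ p.factorial / a ^ p := by
  have h := Real.pow_div_factorial_le_exp (a / x) (by positivity) p
  rw [Real.rpow_neg hx.le, Real.rpow_natCast, neg_div, Real.exp_neg, ← mul_inv]
  rw [inv_le_comm₀ (by positivity) (by positivity), inv_div]
  have hf : (0 : ℝ) < p.factorial := by positivity
  calc a ^ p / p.factorial = x ^ p * ((a / x) ^ p / p.factorial) := by
        rw [div_pow]; field_simp
    _ ≤ _ := by gcongr

section Mixture

variable {f : ℝ → ℝ}

lemma integrableOn_rpow_neg_mul_exp_mul (hfi : Integrable f) (p : ℕ) {a : ℝ} (ha : 0 < a) :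
    IntegrableOn (fun x => x ^ (-(p : ℝ)) * Real.exp (-a / x) * f x) (Set.Ioi 0) := by
  refine hfi.integrableOn.bdd_mul (c := p.factorial / a ^ p) (by fun_prop) ?_
  filter_upwards [ae_restrict_mem measurableSet_Ioi] with x hx
  have hx : 0 < x := hx
  rw [Real.norm_of_nonneg (by positivity)]
  exact rpow_neg_mul_exp_neg_div_le p ha hx

/-- Expansion of the Erlang survival function at `z (x + C) / x`, averaged over `x`. -/
lemma integral_mul_erlang_sum (hfi : Integrable f) (m : ℕ) {r C z : ℝ} (hr : 0 < r)
    (hC : 0 < C) (hz : 0 < z) :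
    ∫ x in Set.Ioi (0 : ℝ), f x * ∑ n ∈ Finset.range m, Real.exp (-r * (z * (x + C) / x))
        * (r * (z * (x + C) / x)) ^ n / n.factorial
      = ∑ n ∈ Finset.range m, ∑ p ∈ Finset.range (n + 1),
        (1 / (n.factorial : ℝ)) * (n.choose p * r ^ n * C ^ p) * (z ^ n * Real.exp (-r * z) *
          ∫ x in Set.Ioi (0 : ℝ), x ^ (-(p : ℝ)) * Real.exp (-(r * C * z) / x) * f x) := by
  have ha : 0 < r * C * z := by positivity
  have hI := fun p => integrableOn_rpow_neg_mul_exp_mul hfi p ha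
  simp_rw [← integral_const_mul]
  have hI2 : ∀ n p : ℕ, IntegrableOn (fun x => (1 / (n.factorial : ℝ)) *
      (n.choose p * r ^ n * C ^ p) * (z ^ n * Real.exp (-r * z) *
        (x ^ (-(p : ℝ)) * Real.exp (-(r * C * z) / x) * f x))) (Set.Ioi 0) :=
    fun n p => ((hI p).const_mul _).const_mul _
  calc _ = ∫ x in Set.Ioi (0 : ℝ), ∑ n ∈ Finset.range m, ∑ p ∈ Finset.range (n + 1),
        (1 / (n.factorial : ℝ)) *
      (n.choose p * r ^ n * C ^ p) * (z ^ n * Real.exp (-r * z) *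
        (x ^ (-(p : ℝ)) * Real.exp (-(r * C * z) / x) * f x)) := by
        refine setIntegral_congr_fun measurableSet_Ioi fun x hx => ?_
        have hx : 0 < x := hx
        rw [Finset.mul_sum]
        refine Finset.sum_congr rfl fun n _ => ?_
        have h1 : -r * (z * (x + C) / x) = -r * z + -(r * C * z) / x := by
          field_simp; ring
        have h2 : r * (z * (x + C) / x) = r * z * (C / x + 1) := by
          field_simp; ring
        rw [h1, Real.exp_add, h2, mul_pow, add_pow]
        simp only [Finset.mul_sum, Finset.sum_div, one_pow, mul_one]
        refine Finset.sum_congr rfl fun p _ => ?_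
        rw [Real.rpow_neg hx.le, Real.rpow_natCast, div_pow, mul_pow]
        ring
    _ = _ := by
        rw [integral_finsetSum _ fun n _ => integrable_finsetSum _ fun p _ => hI2 n p]
        exact Finset.sum_congr rfl fun n _ => integral_finsetSum _ fun p _ => hI2 n p

lemma integrableOn_rpow_mul_exp_mul_integral (hfm : Measurable f) (hf0 : ∀ x, 0 ≤ f x)
    (hfi : Integrable f) {n p : ℕ} (hp : p ≤ n) {a b : ℝ} (ha : 0 < a) (hb : 0 < b) :
    IntegrableOn (fun z : ℝ => z ^ ((n : ℝ) - 1 / 2) * Real.exp (-b * z) *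
      ∫ x in Set.Ioi (0 : ℝ), x ^ (-(p : ℝ)) * Real.exp (-(a * z) / x) * f x) (Set.Ioi 0) := by
  have hmeas : StronglyMeasurable fun z : ℝ =>
      ∫ x in Set.Ioi (0 : ℝ), x ^ (-(p : ℝ)) * Real.exp (-(a * z) / x) * f x := by
    apply StronglyMeasurable.integral_prod_right
    apply Measurable.stronglyMeasurable
    unfold Function.uncurry
    fun_prop
  have hdom : IntegrableOn (fun z : ℝ => (p.factorial / a ^ p * ∫ x in Set.Ioi (0 : ℝ), f x) *
      (z ^ (((n - p : ℕ) : ℝ) - 1 / 2) * Real.exp (-b * z))) (Set.Ioi 0) := by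
    have h := integrableOn_rpow_mul_exp_neg_mul_rpow (p := 1) (s := ((n - p : ℕ) : ℝ) - 1 / 2)
      (by have : (0 : ℝ) ≤ ((n - p : ℕ) : ℝ) := Nat.cast_nonneg _
          linarith) one_pos hb
    simp only [Real.rpow_one] at h
    exact h.const_mul _
  refine hdom.mono' ?_ ?_
  · exact ((by fun_prop : Measurable fun z : ℝ =>
      z ^ ((n : ℝ) - 1 / 2) * Real.exp (-b * z)).aestronglyMeasurable).mul
        hmeas.aestronglyMeasurable
  · filter_upwards [ae_restrict_mem measurableSet_Ioi] with z hz
    have hz : 0 < z := hz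
    have haz : 0 < a * z := by positivity
    have hle : ∫ x in Set.Ioi (0 : ℝ), x ^ (-(p : ℝ)) * Real.exp (-(a * z) / x) * f x
        ≤ p.factorial / (a * z) ^ p * ∫ x in Set.Ioi (0 : ℝ), f x := by
      rw [← integral_const_mul]
      refine setIntegral_mono_on (integrableOn_rpow_neg_mul_exp_mul hfi p haz)
        (hfi.integrableOn.const_mul _) measurableSet_Ioi fun x hx => ?_
      exact mul_le_mul_of_nonneg_right (rpow_neg_mul_exp_neg_div_le p haz hx) (hf0 x)
    have hnn : 0 ≤ ∫ x in Set.Ioi (0 : ℝ), x ^ (-(p : ℝ)) * Real.exp (-(a * z) / x) * f x := by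
      refine setIntegral_nonneg measurableSet_Ioi fun x hx => ?_
      have hx : 0 < x := hx
      have := hf0 x
      positivity
    rw [Real.norm_of_nonneg (by positivity)]
    refine (mul_le_mul_of_nonneg_left hle (by positivity)).trans (le_of_eq ?_)
    have hpow : z ^ ((n : ℝ) - 1 / 2) = z ^ (((n - p : ℕ) : ℝ) - 1 / 2) * z ^ p := by
      rw [← Real.rpow_natCast z p, ← Real.rpow_add hz, Nat.cast_sub hp]
      congr 1; ring
    rw [hpow, mul_pow]
    field_simp

end Mixture

/-- `E[erfc √(τ S)]` in terms of the survival function of `S`. -/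
lemma integral_erfc_sqrt {Θ : Type*} [MeasurableSpace Θ] (P : Measure Θ) [IsProbabilityMeasure P]
    {τ : ℝ} (hτ : 0 < τ) {S : Θ → ℝ} (hS : Measurable S) :
    ∫ ω, erfc (Real.sqrt (τ * S ω)) ∂P = 1 - ∫ z in Set.Ioi (0 : ℝ),
      Real.sqrt (τ / Real.pi) * (z ^ (-(1 / 2) : ℝ) * Real.exp (-τ * z)) * P.real {ω | z < S ω} := by
  simp_rw [erfc_sqrt_eq hτ]
  set w : ℝ → ℝ := fun z => Real.sqrt (τ / Real.pi) * (z ^ (-(1 / 2) : ℝ) * Real.exp (-τ * z))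
    with hw
  have hwi : IntegrableOn w (Set.Ioi 0) := by
    have h := integrableOn_rpow_mul_exp_neg_mul_rpow (p := 1) (s := -(1 / 2)) (by norm_num)
      one_pos hτ
    simp only [Real.rpow_one] at h
    exact h.const_mul _
  have hset : MeasurableSet {q : Θ × ℝ | q.2 < S q.1} :=
    measurableSet_lt measurable_snd (hS.comp measurable_fst)
  have hinteg : Integrable (Function.uncurry fun (ω : Θ) (z : ℝ) =>
      w z * (Set.Iio (S ω)).indicator 1 z) (P.prod (volume.restrict (Set.Ioi 0))) := by
    have h := (hwi.comp_snd P).indicator hset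
    refine h.congr (Filter.Eventually.of_forall fun q => ?_)
    simp [Function.uncurry, Set.indicator]
  have hinteg' : Integrable (fun ω => ∫ z in Set.Ioi (0 : ℝ),
      w z * (Set.Iio (S ω)).indicator 1 z) P := hinteg.integral_prod_left
  change ∫ ω, (1 - ∫ z in Set.Ioi (0 : ℝ), w z * (Set.Iio (S ω)).indicator 1 z) ∂P
    = 1 - ∫ z in Set.Ioi (0 : ℝ), w z * P.real {ω | z < S ω}
  rw [integral_sub (integrable_const _) hinteg', integral_integral_swap hinteg]
  simp only [integral_const, probReal_univ, smul_eq_mul, mul_one]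
  congr 1
  refine integral_congr_ae (Filter.Eventually.of_forall fun z => ?_)
  simp only
  rw [integral_const_mul, ← integral_indicator_one (measurableSet_lt measurable_const hS)]
  congr 1

/-- Exact average symbol error rate integral
`E[erfc √(τ γ₁ γ₂ / (γ₂ + C))]` when `γ₁` is `Gamma (m₁, lam)` with integer shape and `γ₂` is
`α`-`μ` distributed with density `f₂`. -/
theorem aser_end_to_end_battery_case {Θ : Type*} [MeasureSpace Θ]
    [IsProbabilityMeasure (ℙ : Measure Θ)]
    (m₁ : ℕ) (hm₁ : 0 < m₁) (lam C τ α₂ μ₂ Υb : ℝ)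
    (hlam : 0 < lam) (hC : 0 < C) (hτ : 0 < τ)
    (hα₂ : 0 < α₂) (hμ₂ : 0 < μ₂) (hΥb : 0 < Υb)
    (γ₁ γ₂ : Θ → ℝ) (hγ₁m : Measurable γ₁) (hγ₂m : Measurable γ₂)
    (hindep : IndepFun γ₁ γ₂ ℙ)
    (hγ₁ : Measure.map γ₁ ℙ = volume.withDensity fun x => ENNReal.ofReal
      (if 0 < x then lam ^ m₁ * x ^ (m₁ - 1) * Real.exp (-lam * x) / Real.Gamma (m₁ : ℝ)
       else 0))
    (f₂ : ℝ → ℝ)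
    (hf₂ : ∀ x : ℝ, f₂ x = if 0 < x then
        α₂ * μ₂ ^ μ₂ / (2 * Real.Gamma μ₂ * Υb) * (x / Υb) ^ (α₂ * μ₂ / 2 - 1)
          * Real.exp (-μ₂ * (x / Υb) ^ (α₂ / 2)) else 0)
    (hγ₂ : Measure.map γ₂ ℙ = volume.withDensity fun x => ENNReal.ofReal (f₂ x)) :
    ∫ ω, erfc (Real.sqrt (τ * (γ₁ ω * γ₂ ω / (γ₂ ω + C))))
      = 1 - Real.sqrt (τ / Real.pi) * ∑ n ∈ Finset.range m₁, (1 / (n.factorial : ℝ)) *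
          ∑ p ∈ Finset.range (n + 1),
            (n.choose p : ℝ) * lam ^ n * C ^ p *
              ∫ z in Set.Ioi (0 : ℝ), z ^ ((n : ℝ) - 1 / 2) * Real.exp (-(τ + lam) * z) *
                ∫ x in Set.Ioi (0 : ℝ),
                  x ^ (-(p : ℝ)) * Real.exp (-(lam * C * z) / x) * f₂ x := by
  have hfm : Measurable f₂ := by
    rw [funext hf₂]
    exact Measurable.ite measurableSet_Ioi (by fun_prop) measurable_const
  have hf0 : ∀ x, 0 ≤ f₂ x := by
    intro x
    rw [hf₂]
    split_ifs with hx
    · have := Real.Gamma_pos_of_pos hμ₂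
      positivity
    · exact le_rfl
  have hfi : Integrable f₂ := by
    refine ⟨hfm.aestronglyMeasurable, ?_⟩
    rw [hasFiniteIntegral_iff_ofReal (Filter.Eventually.of_forall hf0),
      ← setLIntegral_univ, ← withDensity_apply _ MeasurableSet.univ, ← hγ₂]
    exact measure_lt_top _ _
  have hsurv : ∀ z ∈ Set.Ioi (0 : ℝ),
      (ℙ : Measure Θ).real {ω | z < γ₁ ω * γ₂ ω / (γ₂ ω + C)}
      = ∫ x in Set.Ioi (0 : ℝ), f₂ x * ∑ n ∈ Finset.range m₁,
        Real.exp (-lam * (z * (x + C) / x)) * (lam * (z * (x + C) / x)) ^ n / n.factorial := by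
    intro z hz
    have hz : 0 < z := hz
    have hset : MeasurableSet {q : ℝ × ℝ | z < q.1 * q.2 / (q.2 + C)} :=
      measurableSet_lt measurable_const (by fun_prop)
    have hmap := (indepFun_iff_map_prod_eq_prod_map_map hγ₁m.aemeasurable
      hγ₂m.aemeasurable).mp hindep
    have := Measure.isProbabilityMeasure_map (μ := (ℙ : Measure Θ)) hγ₁m.aemeasurable
    have := Measure.isProbabilityMeasure_map (μ := (ℙ : Measure Θ)) hγ₂m.aemeasurable
    have h1 : (ℙ : Measure Θ) {ω | z < γ₁ ω * γ₂ ω / (γ₂ ω + C)}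
        = ∫⁻ x in Set.Ioi (0 : ℝ), ENNReal.ofReal (f₂ x * ∑ n ∈ Finset.range m₁,
          Real.exp (-lam * (z * (x + C) / x)) * (lam * (z * (x + C) / x)) ^ n / n.factorial) := by
      have h2 : {ω | z < γ₁ ω * γ₂ ω / (γ₂ ω + C)}
          = (fun ω => (γ₁ ω, γ₂ ω)) ⁻¹' {q : ℝ × ℝ | z < q.1 * q.2 / (q.2 + C)} := rfl
      rw [h2, ← Measure.map_apply (hγ₁m.prodMk hγ₂m) hset, hmap, Measure.prod_apply_symm hset]
      have hmeas := measurable_measure_prodMk_right (μ := Measure.map γ₁ ℙ) hset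
      rw [hγ₂, lintegral_withDensity_eq_lintegral_mul _ hfm.ennreal_ofReal hmeas,
        ← lintegral_indicator measurableSet_Ioi]
      refine lintegral_congr fun x => ?_
      by_cases hx : 0 < x
      · rw [Set.indicator_of_mem (Set.mem_Ioi.mpr hx), ENNReal.ofReal_mul (hf0 x), Pi.mul_apply]
        congr 1
        have ht : 0 < z * (x + C) / x := by positivity
        rw [← setLIntegral_Ioi_erlang hm₁ hlam ht.le]
        have h3 : (fun y => (y, x)) ⁻¹' {q : ℝ × ℝ | z < q.1 * q.2 / (q.2 + C)}
            = Set.Ioi (z * (x + C) / x) := by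
          ext y
          simp only [Set.mem_preimage, Set.mem_ofPred_eq, Set.mem_Ioi]
          rw [lt_div_iff₀ (by positivity), div_lt_iff₀ hx]
        rw [h3, hγ₁, withDensity_apply _ measurableSet_Ioi]
        refine setLIntegral_congr_fun measurableSet_Ioi fun y hy => ?_
        simp only [if_pos (ht.trans hy)]
      · rw [Set.indicator_of_notMem (by simpa using hx), Pi.mul_apply, hf₂, if_neg hx]
        simp
    rw [integral_eq_lintegral_of_nonneg_ae, Measure.real, h1]
    · filter_upwards [ae_restrict_mem measurableSet_Ioi] with x hx
      have hx : 0 < x := hx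
      have := hf0 x
      simp only [Pi.zero_apply]
      positivity
    · exact (by fun_prop : Measurable _).aestronglyMeasurable
  rw [integral_erfc_sqrt _ hτ (by fun_prop)]
  congr 1
  set T : ℕ → ℕ → ℝ → ℝ := fun n p z =>
      Real.sqrt (τ / Real.pi) * ((1 / (n.factorial : ℝ)) * ((n.choose p * lam ^ n * C ^ p) *
        (z ^ ((n : ℝ) - 1 / 2) * Real.exp (-(τ + lam) * z) *
        ∫ x in Set.Ioi (0 : ℝ), x ^ (-(p : ℝ)) * Real.exp (-(lam * C * z) / x) * f₂ x))) with hT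
  have hI : ∀ n, ∀ p ∈ Finset.range (n + 1), IntegrableOn (T n p) (Set.Ioi 0) := fun n p hp =>
    (((integrableOn_rpow_mul_exp_mul_integral hfm hf0 hfi
      (Nat.lt_succ_iff.mp (Finset.mem_range.mp hp)) (mul_pos hlam hC)
      (add_pos hτ hlam)).const_mul _).const_mul _).const_mul _
  trans ∑ n ∈ Finset.range m₁, ∑ p ∈ Finset.range (n + 1), ∫ z in Set.Ioi (0 : ℝ), T n p z
  swap
  · simp only [hT, Finset.mul_sum, integral_const_mul]
  rw [Finset.sum_congr rfl fun n _ => (integral_finsetSum _ (hI n)).symm,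
    ← integral_finsetSum _ fun n _ => integrable_finsetSum _ (hI n)]
  refine setIntegral_congr_fun measurableSet_Ioi fun z hz => ?_
  have hz' : 0 < z := hz
  rw [hsurv z hz, integral_mul_erlang_sum hfi m₁ hlam hC hz']
  simp only [hT, Finset.mul_sum]
  refine Finset.sum_congr rfl fun n _ => Finset.sum_congr rfl fun p _ => ?_
  have h1 : z ^ ((n : ℝ) - 1 / 2) = z ^ n * z ^ (-(1 / 2) : ℝ) := by
    rw [sub_eq_add_neg, Real.rpow_add hz', Real.rpow_natCast]
  have h2 : Real.exp (-(τ + lam) * z) = Real.exp (-τ * z) * Real.exp (-lam * z) := by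
    rw [← Real.exp_add]; congr 1; ring
  rw [h1, h2]
  ring
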